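/- Let n ≥ 3, 1 ≤ p < ∞, and suppose Φ : P_o^n → C_p(ℝ^n) satisfies Φ(P) = c₁·h_{M_p⁺P}^p + c₂·h_{M_p⁻P}^p + Φ_{p;a₁,a₂}(P) + Φ_{p;b₁,b₂}(−P) for every P ∈ P_o^n, where a₁, a₂, b₁, b₂, c₁, c₂ ∈ ℝ. Assume Φ(P) is non-negative and (Φ(P))^{1/p} is sublinear for all P ∈ P_o^n. Then a₁, a₂, b₁, b₂, c₁, c₂ ≥ 0; moreover, if n ≥ 3 and p > 1, or n ≥ 4 and p = 1, then a₁ = a₂ and b₁ = b₂; and if n = 3 and p = 1, then a₁ ≤ a₂, b₁ ≤ b₂, a₂ − a₁ ≤ b₂ and b₂ − b₁ ≤ a₂. -/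

import Mathlib

open scoped RealInnerProductSpace BigOperators Pointwise ENNReal
open MeasureTheory Filter Matrix

noncomputable section

/-- `Euc n` is Euclidean space `ℝ^n`. -/
abbrev Euc (n : ℕ) := EuclideanSpace ℝ (Fin n)

/-- A convex body in `ℝ^n` containing the origin: a nonempty compact convex set with `0 ∈ K`. -/
def IsConvexBody0 {n : ℕ} (K : Set (Euc n)) : Prop :=
  IsCompact K ∧ Convex ℝ K ∧ (0 : Euc n) ∈ K

/-- A convex polytope in `ℝ^n` containing the origin. -/
def IsPolytope0 {n : ℕ} (P : Set (Euc n)) : Prop :=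
  (∃ S : Finset (Euc n), P = convexHull ℝ (S : Set (Euc n))) ∧ (0 : Euc n) ∈ P

/-- The support function `h_K(x) = sup { ⟪x, y⟫ : y ∈ K }`. -/
def supp {n : ℕ} (K : Set (Euc n)) (x : Euc n) : ℝ :=
  sSup ((fun y => ⟪x, y⟫) '' K)

/-- The image of a set under the linear map induced by a matrix. -/
def matAct {n : ℕ} (A : Matrix (Fin n) (Fin n) ℝ) (K : Set (Euc n)) : Set (Euc n) :=
  (Matrix.toEuclideanLin A) '' K

/-- The vector `A x`. -/
def matVec {n : ℕ} (A : Matrix (Fin n) (Fin n) ℝ) (x : Euc n) : Euc n :=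
  Matrix.toEuclideanLin A x

/-- The dimension of a set: the dimension of (the direction of) its affine hull. -/
def sdim {n : ℕ} (P : Set (Euc n)) : ℕ :=
  Module.finrank ℝ (affineSpan ℝ P).direction

/-- Support function of the asymmetric `L_p` moment body:
`h_{M_p⁺K}(x) = (∫_K max(⟪x,y⟫,0)^p dy)^(1/p)`. -/
def mPlus {n : ℕ} (p : ℝ) (K : Set (Euc n)) (x : Euc n) : ℝ :=
  (∫ y in K, max ⟪x, y⟫ 0 ^ p) ^ (1 / p)

/-- Support function of the asymmetric `L_p` moment body `M_p⁻`. -/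
def mMinus {n : ℕ} (p : ℝ) (K : Set (Euc n)) (x : Euc n) : ℝ :=
  (∫ y in K, max (-⟪x, y⟫) 0 ^ p) ^ (1 / p)

/-- The set of `j`-dimensional faces of `P` containing the origin (faces of a polytope
being exactly its exposed faces). -/
def facesO {n : ℕ} (j : ℕ) (P : Set (Euc n)) : Set (Set (Euc n)) :=
  {F | IsExposed ℝ P F ∧ sdim F = j ∧ (0 : Euc n) ∈ F}

/-- The function-valued valuation `Φ_{p;a₁,a₂}`:
`Φ_{p;a₁,a₂}(P) = a₁ h_P^p + (a₂-a₁) Σ_{1≤j≤dim P-1} (-1)^j Σ_{F ∈ F_{j,o}(P)} h_F^p` if `dim P` is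
odd, and with leading coefficient `2a₂ - a₁` instead of `a₁` if `dim P` is even. -/
def PhiP {n : ℕ} (p a₁ a₂ : ℝ) (P : Set (Euc n)) : Euc n → ℝ := fun x =>
  (if Odd (sdim P) then a₁ else 2 * a₂ - a₁) * supp P x ^ p
    + (a₂ - a₁) * ∑ j ∈ Finset.Icc 1 (sdim P - 1),
        (-1 : ℝ) ^ j * ∑ᶠ F ∈ facesO j P, supp F x ^ p

open Set

theorem supp_nonneg {n : ℕ} {K : Set (Euc n)} (h0 : (0 : Euc n) ∈ K) (x : Euc n) :
    0 ≤ supp K x := by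
  unfold supp
  by_cases hb : BddAbove ((fun y => ⟪x, y⟫) '' K)
  · exact le_csSup hb ⟨0, h0, by simp⟩
  · rw [Real.sSup_of_not_bddAbove hb]

theorem supp_smul_set {n : ℕ} (c : ℝ) (K : Set (Euc n)) (x : Euc n) :
    supp (c • K) x = supp K (c • x) := by
  unfold supp
  rw [← Set.image_smul, Set.image_image]
  simp [inner_smul_left, inner_smul_right]

theorem supp_smul_of_nonneg {n : ℕ} {c : ℝ} (hc : 0 ≤ c) (K : Set (Euc n)) (x : Euc n) :
    supp K (c • x) = c * supp K x := by
  unfold supp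
  rw [← smul_eq_mul, ← Real.sSup_smul_of_nonneg hc, ← Set.image_smul, Set.image_image]
  simp [inner_smul_left]

theorem sdim_smul {n : ℕ} {c : ℝ} (hc : c ≠ 0) (K : Set (Euc n)) :
    sdim (c • K) = sdim K := by
  let L : Euc n ≃ₗ[ℝ] Euc n := LinearEquiv.smulOfNeZero ℝ _ c hc
  have h : c • K = L.toLinearMap.toAffineMap '' K := by
    ext y; simp [L, Set.mem_smul_set]
  unfold sdim
  rw [h, ← AffineSubspace.map_span, AffineSubspace.map_direction]
  exact LinearEquiv.finrank_map_eq L _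

theorem IsExposed.smul_set {n : ℕ} {c : ℝ} (hc : c ≠ 0) {P F : Set (Euc n)}
    (h : IsExposed ℝ P F) : IsExposed ℝ (c • P) (c • F) := by
  intro hne
  obtain ⟨l, hl⟩ := h (by simpa using hne)
  refine ⟨c⁻¹ • l, ?_⟩
  ext y
  simp only [Set.mem_smul_set_iff_inv_smul_mem₀ hc, mem_ofPred_eq]
  conv_lhs => rw [hl]
  simp only [mem_ofPred_eq]
  refine and_congr_right fun _ => ⟨fun H z hz => ?_, fun H z hz => ?_⟩
  · simpa using H _ hz
  · simpa [hc] using H (c • z) (by simpa [hc] using hz)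

theorem facesO_smul {n : ℕ} {c : ℝ} (hc : c ≠ 0) (j : ℕ) (P : Set (Euc n)) :
    facesO j (c • P) = (fun F => c • F) '' facesO j P := by
  ext F
  constructor
  · rintro ⟨h1, h2, h3⟩
    refine ⟨c⁻¹ • F, ⟨?_, ?_, ?_⟩, by simp [hc]⟩
    · simpa [hc] using h1.smul_set (inv_ne_zero hc)
    · rw [sdim_smul (inv_ne_zero hc), h2]
    · exact ⟨0, h3, by simp⟩
  · rintro ⟨G, ⟨h1, h2, h3⟩, rfl⟩
    exact ⟨h1.smul_set hc, by rw [sdim_smul hc, h2], ⟨0, h3, by simp⟩⟩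

theorem PhiP_smul_set {n : ℕ} {c : ℝ} (hc : c ≠ 0) (p a₁ a₂ : ℝ) (P : Set (Euc n)) (x : Euc n) :
    PhiP p a₁ a₂ (c • P) x = PhiP p a₁ a₂ P (c • x) := by
  unfold PhiP
  simp only [sdim_smul hc, facesO_smul hc, supp_smul_set]
  congr 2
  refine Finset.sum_congr rfl fun j _ => ?_
  rw [finsum_mem_image (Set.injOn_of_injective (MulAction.injective₀ hc))]
  simp only [supp_smul_set]

theorem PhiP_neg_set {n : ℕ} (p a₁ a₂ : ℝ) (P : Set (Euc n)) (x : Euc n) :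
    PhiP p a₁ a₂ (-P) x = PhiP p a₁ a₂ P (-x) := by
  have h : -P = (-1 : ℝ) • P := by
    ext; simp
  rw [h, PhiP_smul_set (by norm_num)]
  simp

theorem PhiP_smul_of_nonneg {n : ℕ} {c : ℝ} (hc : 0 ≤ c) (p a₁ a₂ : ℝ) {P : Set (Euc n)}
    (h0 : (0 : Euc n) ∈ P) (x : Euc n) :
    PhiP p a₁ a₂ P (c • x) = c ^ p * PhiP p a₁ a₂ P x := by
  unfold PhiP
  have key : ∀ F : Set (Euc n), (0 : Euc n) ∈ F →
      supp F (c • x) ^ p = c ^ p * supp F x ^ p := fun F hF => by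
    rw [supp_smul_of_nonneg hc, Real.mul_rpow hc (supp_nonneg hF x)]
  have hfin : ∀ j, ∑ᶠ F ∈ facesO j P, supp F (c • x) ^ p
      = c ^ p * ∑ᶠ F ∈ facesO j P, supp F x ^ p := fun j => by
    rw [← smul_eq_mul, smul_finsum]
    refine finsum_congr fun F => ?_
    rw [smul_finsum]
    exact finsum_congr fun hF => key F hF.2.2
  simp only [key P h0, hfin, mul_add, Finset.mul_sum]
  congr 1
  · ring
  · refine Finset.sum_congr rfl fun j _ => by ring

theorem IsPolytope0.smul_set {n : ℕ} {P : Set (Euc n)} (hP : IsPolytope0 P) (c : ℝ) :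
    IsPolytope0 (c • P) := by
  classical
  obtain ⟨⟨S, rfl⟩, h0⟩ := hP
  refine ⟨⟨S.image (fun y => c • y), ?_⟩, ⟨0, h0, by simp⟩⟩
  rw [← convexHull_smul]
  simp [Set.image_smul]

theorem integral_moment_nonneg {n : ℕ} (p : ℝ) (P : Set (Euc n)) (x : Euc n) :
    0 ≤ ∫ y in P, max ⟪x, y⟫ 0 ^ p :=
  integral_nonneg fun _ => Real.rpow_nonneg (le_max_right _ _) _

theorem mPlus_rpow {n : ℕ} {p : ℝ} (hp : p ≠ 0) (P : Set (Euc n)) (x : Euc n) :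
    mPlus p P x ^ p = ∫ y in P, max ⟪x, y⟫ 0 ^ p := by
  unfold mPlus
  rw [← Real.rpow_mul (integral_moment_nonneg p P x), one_div_mul_cancel hp, Real.rpow_one]

theorem mMinus_eq_mPlus_neg {n : ℕ} (p : ℝ) (P : Set (Euc n)) (x : Euc n) :
    mMinus p P x = mPlus p P (-x) := by
  simp [mMinus, mPlus, inner_neg_left]

theorem mPlus_rpow_smul {n : ℕ} {p s : ℝ} (hp : p ≠ 0) (hs : 0 < s) (P : Set (Euc n))
    (x : Euc n) : mPlus p (s • P) x ^ p = s ^ p * (s ^ n * mPlus p P x ^ p) := by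
  rw [mPlus_rpow hp, mPlus_rpow hp]
  have h := Measure.setIntegral_comp_smul_of_pos (volume : Measure (Euc n))
    (fun y => max ⟪x, y⟫ 0 ^ p) P hs
  have h2 : ∀ y : Euc n, max ⟪x, s • y⟫ 0 ^ p = s ^ p * max ⟪x, y⟫ 0 ^ p := fun y => by
    rw [inner_smul_right, ← Real.mul_rpow hs.le (le_max_right _ _), mul_max_of_nonneg _ _ hs.le,
      mul_zero]
  simp only [h2, integral_const_mul, finrank_euclideanSpace_fin, smul_eq_mul] at h
  have hsn : s ^ n ≠ 0 := by positivity
  field_simp at h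
  linarith

theorem integral_moment_pos {n : ℕ} {p : ℝ} (hp : 0 < p) {S : Finset (Euc n)}
    (hS : affineSpan ℝ (S : Set (Euc n)) = ⊤) {x z : Euc n} (hz : z ∈ S) (hxz : 0 < ⟪x, z⟫) :
    0 < ∫ y in convexHull ℝ (S : Set (Euc n)), max ⟪x, y⟫ 0 ^ p := by
  set P := convexHull ℝ (S : Set (Euc n)) with hP
  have hcont : Continuous fun y : Euc n => max ⟪x, y⟫ 0 ^ p :=
    Continuous.rpow_const (by fun_prop) fun _ => Or.inr hp.le
  have hcomp : IsCompact P := S.finite_toSet.isCompact_convexHull (𝕜 := ℝ)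
  rw [setIntegral_pos_iff_support_of_nonneg_ae
    (Eventually.of_forall fun _ => Real.rpow_nonneg (le_max_right _ _) _)
    (hcont.continuousOn.integrableOn_compact hcomp)]
  have hnonempty : (interior P).Nonempty := interior_convexHull_nonempty_iff_affineSpan_eq_top.2 hS
  have hopen : IsOpen {y : Euc n | 0 < ⟪x, y⟫} := isOpen_lt (by fun_prop) (by fun_prop)
  have hzc : z ∈ closure (interior P) := by
    rw [Convex.closure_interior_eq_closure_of_nonempty_interior (𝕜 := ℝ)
      (convex_convexHull ℝ _) hnonempty]
    exact subset_closure (subset_convexHull ℝ _ hz)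
  obtain ⟨y, hy1, hy2⟩ := mem_closure_iff.1 hzc _ hopen hxz
  refine lt_of_lt_of_le ((hopen.inter isOpen_interior).measure_pos volume ⟨y, hy1, hy2⟩)
    (measure_mono ?_)
  rintro w ⟨hw1, hw2⟩
  refine ⟨?_, interior_subset hw2⟩
  simp only [Function.mem_support]
  exact (Real.rpow_pos_of_pos (lt_max_of_lt_left hw1) _).ne'

theorem integral_moment_eq_zero {n : ℕ} {p : ℝ} (hp : 0 < p) {S : Set (Euc n)} {x : Euc n}
    (h : ∀ y ∈ S, ⟪x, y⟫ ≤ 0) (hm : MeasurableSet (convexHull ℝ S)) :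
    ∫ y in convexHull ℝ S, max ⟪x, y⟫ 0 ^ p = 0 := by
  rw [setIntegral_congr_fun (g := fun _ => 0) hm]
  · simp
  intro y hy
  have hc : Convex ℝ {y : Euc n | ⟪x, y⟫ ≤ 0} :=
    convex_halfSpace_le (innerₛₗ ℝ x).isLinear 0
  have : ⟪x, y⟫ ≤ 0 := convexHull_min h hc hy
  simp [max_eq_right this, Real.zero_rpow (ne_of_gt hp)]

/-- A full-dimensional simplex separates the two moment bodies. -/
theorem exists_polytope_mPlus_pos {n : ℕ} (hn : 0 < n) {p : ℝ} (hp : 0 < p) :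
    ∃ P : Set (Euc n), IsPolytope0 P ∧ ∃ x : Euc n,
      0 < mPlus p P x ^ p ∧ mPlus p P (-x) ^ p = 0 := by
  classical
  let b : Fin n → Euc n := fun i => EuclideanSpace.single i 1
  let S : Finset (Euc n) := insert 0 (Finset.univ.image b)
  have hspan : Submodule.span ℝ (Set.range b) = ⊤ := by
    have := (EuclideanSpace.basisFun (Fin n) ℝ).toBasis.span_eq
    simpa [b, Set.range, funext_iff] using this
  have hS : affineSpan ℝ (S : Set (Euc n)) = ⊤ := by
    rw [← AffineSubspace.coe_eq_univ_iff]
    simp only [S, Finset.coe_insert, Finset.coe_image, Finset.coe_univ, Set.image_univ]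
    rw [affineSpan_insert_zero, hspan]
    simp
  let x : Euc n := ∑ i, b i
  have hx : ∀ i, ⟪x, b i⟫ = 1 := fun i => by
    simp [x, b, sum_inner, EuclideanSpace.inner_single_left]
  refine ⟨convexHull ℝ S, ⟨⟨S, rfl⟩, subset_convexHull ℝ _ (by simp [S])⟩, x, ?_, ?_⟩
  · rw [mPlus_rpow hp.ne']
    exact integral_moment_pos hp hS (z := b ⟨0, hn⟩) (by simp [S]) (by simp [hx])
  · rw [mPlus_rpow hp.ne']
    refine integral_moment_eq_zero hp ?_ (S.finite_toSet.isCompact_convexHull (𝕜 := ℝ)).measurableSet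
    intro y hy
    simp only [S, Finset.coe_insert, Finset.coe_image, Finset.coe_univ, Set.image_univ,
      Set.mem_insert_iff, Set.mem_range] at hy
    rcases hy with rfl | ⟨i, rfl⟩
    · simp
    · simp [inner_neg_left, hx]

theorem leading_coeff_nonneg_of_forall_scaled {n : ℕ} (hn : 0 < n) {A B : ℝ}
    (h : ∀ s : ℝ, 0 < s → 0 ≤ s ^ n * A + B) : 0 ≤ A := by
  have hlim : Tendsto (fun s : ℝ => A + B / s ^ n) atTop (nhds (A + 0)) :=
    tendsto_const_nhds.add (Tendsto.div_atTop tendsto_const_nhds (tendsto_pow_atTop hn.ne'))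
  rw [add_zero] at hlim
  refine ge_of_tendsto hlim ?_
  filter_upwards [eventually_gt_atTop 0] with s hs
  have h1 := h s hs
  have h2 : 0 < s ^ n := by positivity
  have h3 : A + B / s ^ n = (s ^ n * A + B) / s ^ n := by field_simp
  rw [h3]
  positivity

theorem rpow_add_le_of_forall_scaled {n : ℕ} (hn : 0 < n) {q A B C A' B' C' : ℝ} (hq : 0 ≤ q)
    (h : ∀ s : ℝ, 0 < s →
      (s ^ n * A + A') ^ q ≤ (s ^ n * B + B') ^ q + (s ^ n * C + C') ^ q) :
    A' ^ q ≤ B' ^ q + C' ^ q := by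
  have hlim : ∀ A A' : ℝ, Tendsto (fun s : ℝ => (s ^ n * A + A') ^ q) (nhdsWithin 0 (Ioi 0))
      (nhds (A' ^ q)) := fun A A' => by
    have hc : Continuous fun s : ℝ => (s ^ n * A + A') ^ q :=
      Continuous.rpow_const (by fun_prop) fun _ => Or.inr hq
    have := (hc.tendsto 0).mono_left (nhdsWithin_le_nhds (s := Ioi 0))
    simpa [hn.ne'] using this
  refine le_of_tendsto_of_tendsto (hlim A A') ((hlim B B').add (hlim C C')) ?_
  filter_upwards [self_mem_nhdsWithin] with s hs using h s hs

theorem nonneg_of_forall_scaled {n : ℕ} (hn : 0 < n) {A B : ℝ}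
    (h : ∀ s : ℝ, 0 < s → 0 ≤ s ^ n * A + B) : 0 ≤ B := by
  have hc : Continuous fun s : ℝ => s ^ n * A + B := by fun_prop
  have hlim := (hc.tendsto 0).mono_left (nhdsWithin_le_nhds (s := Ioi 0))
  refine ge_of_tendsto (by simpa [hn.ne'] using hlim) ?_
  filter_upwards [self_mem_nhdsWithin] with s hs using h s hs

/-- The polytope spanned by the points of `W` and the points `v i`, `i ∈ J`. -/
def spanPoly {n m : ℕ} (W : Finset (Euc n)) (v : Fin m → Euc n) (J : Finset (Fin m)) :
    Set (Euc n) :=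
  convexHull ℝ ((W : Set (Euc n)) ∪ Set.image v J)

/-- `W` is a symmetric set orthogonal to the orthonormal family `v`, with `0` in its
convex hull. -/
structure IsFrame {n m : ℕ} (W : Finset (Euc n)) (v : Fin m → Euc n) : Prop where
  orthonormal : Orthonormal ℝ v
  zero_mem : (0 : Euc n) ∈ convexHull ℝ (W : Set (Euc n))
  neg_mem : ∀ w ∈ W, -w ∈ W
  orthogonal : ∀ w ∈ W, ∀ i, ⟪v i, w⟫ = 0

namespace IsFrame

variable {n m : ℕ} {W : Finset (Euc n)} {v : Fin m → Euc n}

theorem zero_mem_spanPoly (h : IsFrame W v) (J : Finset (Fin m)) :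
    (0 : Euc n) ∈ spanPoly W v J :=
  convexHull_mono Set.subset_union_left h.zero_mem

theorem isPolytope0 (h : IsFrame W v) (J : Finset (Fin m)) : IsPolytope0 (spanPoly W v J) := by
  classical
  exact ⟨⟨W ∪ J.image v, by simp [spanPoly]⟩, h.zero_mem_spanPoly J⟩

theorem inner_eq (h : IsFrame W v) (i j : Fin m) : ⟪v i, v j⟫ = if i = j then 1 else 0 := by
  classical
  exact orthonormal_iff_ite.1 h.orthonormal i j

theorem supp_spanPoly (h : IsFrame W v) (J : Finset (Fin m)) {x : Euc n}
    (hx : ∀ w ∈ W, ⟪x, w⟫ = 0) :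
    supp (spanPoly W v J) x = J.fold max 0 fun i => ⟪x, v i⟫ := by
  have hle : ∀ y ∈ spanPoly W v J, ⟪x, y⟫ ≤ J.fold max 0 fun i => ⟪x, v i⟫ := fun y hy => by
    have hc : Convex ℝ {y : Euc n | ⟪x, y⟫ ≤ J.fold max 0 fun i => ⟪x, v i⟫} :=
      convex_halfSpace_le (innerₛₗ ℝ x).isLinear _
    refine convexHull_min ?_ hc hy
    rintro z (hz | ⟨i, hi, rfl⟩)
    · simp only [Set.mem_ofPred_eq, hx z hz]
      exact (Finset.le_fold_max _).2 (Or.inl le_rfl)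
    · rw [Set.mem_ofPred_eq]
      exact (Finset.le_fold_max _).2 (Or.inr ⟨i, hi, le_rfl⟩)
  have hbdd : BddAbove ((fun y => ⟪x, y⟫) '' spanPoly W v J) :=
    ⟨_, by rintro _ ⟨y, hy, rfl⟩; exact hle y hy⟩
  unfold supp
  refine le_antisymm (csSup_le (Set.Nonempty.image _ ⟨0, h.zero_mem_spanPoly J⟩) ?_) ?_
  · rintro _ ⟨y, hy, rfl⟩; exact hle y hy
  · refine (Finset.fold_max_le _).2 ⟨supp_nonneg (h.zero_mem_spanPoly J) x, fun i hi => ?_⟩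
    exact le_csSup hbdd ⟨v i, subset_convexHull ℝ _ (Or.inr ⟨i, hi, rfl⟩), rfl⟩

theorem mem_spanPoly_iff (h : IsFrame W v) (J : Finset (Fin m)) (i : Fin m) :
    v i ∈ spanPoly W v J ↔ i ∈ J := by
  refine ⟨fun hi => ?_, fun hi => subset_convexHull ℝ _ (Or.inr ⟨i, hi, rfl⟩)⟩
  by_contra hJ
  have hc : Convex ℝ {y : Euc n | ⟪v i, y⟫ ≤ 0} :=
    convex_halfSpace_le (innerₛₗ ℝ (v i)).isLinear _
  have : ⟪v i, v i⟫ ≤ 0 := by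
    refine convexHull_min ?_ hc hi
    rintro z (hz | ⟨j, hj, rfl⟩)
    · simp [h.orthogonal z hz]
    · have : i ≠ j := fun e => hJ (e ▸ hj)
      simp [h.inner_eq, this]
  rw [h.inner_eq, if_pos rfl] at this
  linarith

theorem spanPoly_injective (h : IsFrame W v) : Function.Injective (spanPoly W v) := fun J K e => by
  ext i
  rw [← h.mem_spanPoly_iff, ← h.mem_spanPoly_iff, e]

theorem sdim_spanPoly (h : IsFrame W v) (J : Finset (Fin m)) :
    sdim (spanPoly W v J) = Module.finrank ℝ (Submodule.span ℝ (W : Set (Euc n))) + J.card := by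
  classical
  have hspan : affineSpan ℝ (spanPoly W v J)
      = (Submodule.span ℝ ((W : Set (Euc n)) ∪ v '' J)).toAffineSubspace := by
    apply SetLike.coe_injective
    rw [← Set.insert_eq_of_mem (h.zero_mem_spanPoly J), affineSpan_insert_zero]
    refine congrArg SetLike.coe (?_ : Submodule.span ℝ _ = Submodule.span ℝ _)
    exact le_antisymm (Submodule.span_le.2 (convexHull_min Submodule.subset_span
      (Submodule.convex _))) (Submodule.span_mono (subset_convexHull ℝ _))
  unfold sdim
  rw [hspan, Submodule.toAffineSubspace_direction, Submodule.span_union]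
  have horth : Submodule.span ℝ (W : Set (Euc n)) ⟂ Submodule.span ℝ (v '' J) := by
    rw [Submodule.isOrtho_span]
    rintro w hw _ ⟨i, -, rfl⟩
    rw [real_inner_comm, h.orthogonal w hw]
  have h1 := Submodule.finrank_sup_add_finrank_inf_eq (Submodule.span ℝ (W : Set (Euc n)))
    (Submodule.span ℝ (v '' J))
  rw [horth.disjoint.eq_bot, finrank_bot, add_zero] at h1
  rw [h1]
  congr 1
  have h2 : LinearIndepOn ℝ id ((J.image v : Finset (Euc n)) : Set (Euc n)) := by
    rw [Finset.coe_image]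
    exact (h.orthonormal.linearIndependent.linearIndepOn_id).mono (Set.image_subset_range _ _)
  have h3 := finrank_span_finset_eq_card h2
  rw [Finset.coe_image] at h3
  rw [h3, Finset.card_image_of_injective _ h.orthonormal.linearIndependent.injective]

end IsFrame

/-- The part of a convex hull on which a nonpositive linear functional vanishes. -/
theorem mem_convexHull_sep_of_eq_zero {E : Type*} [AddCommGroup E] [Module ℝ E] {S : Set E}
    (l : E →ₗ[ℝ] ℝ) (hS : ∀ s ∈ S, l s ≤ 0) {y : E} (hy : y ∈ convexHull ℝ S) (hl : l y = 0) :
    y ∈ convexHull ℝ {s ∈ S | l s = 0} := by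
  set C := convexHull ℝ {s ∈ S | l s = 0} with hC
  have hC0 : ∀ z ∈ C, l z = 0 := fun z hz =>
    convexHull_min (t := {z | l z = 0}) (fun s hs => hs.2) (convex_hyperplane l.isLinear 0) hz
  have hconv : Convex ℝ {z | l z < 0 ∨ z ∈ C} := by
    have hle : ∀ z, (l z < 0 ∨ z ∈ C) → l z ≤ 0 := fun z hz =>
      hz.elim le_of_lt fun h => (hC0 z h).le
    rw [convex_iff_forall_pos]
    intro a ha b hb s t hs ht hst
    by_cases hlt : l a < 0 ∨ l b < 0
    · left
      rw [map_add, map_smul, map_smul, smul_eq_mul, smul_eq_mul]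
      rcases hlt with h | h
      · nlinarith [hle b hb, mul_neg_of_pos_of_neg hs h, mul_nonneg ht.le (neg_nonneg.2 (hle b hb))]
      · nlinarith [hle a ha, mul_neg_of_pos_of_neg ht h, mul_nonneg hs.le (neg_nonneg.2 (hle a ha))]
    · push Not at hlt
      right
      exact convex_convexHull ℝ _ (ha.resolve_left hlt.1.not_gt) (hb.resolve_left hlt.2.not_gt)
        hs.le ht.le hst
  have hsub : S ⊆ {z | l z < 0 ∨ z ∈ C} := fun s hs =>
    (hS s hs).lt_or_eq.imp id fun h => subset_convexHull ℝ _ ⟨hs, h⟩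
  exact (convexHull_min hsub hconv hy).resolve_left hl.not_lt

/-- The zero set of a supporting functional on a polytope is the face spanned by its zeros. -/
theorem sep_eq_spanPoly {n m : ℕ} {W : Finset (Euc n)} {v : Fin m → Euc n} (l : Euc n →ₗ[ℝ] ℝ) (J : Finset (Fin m))
    (hW : ∀ w ∈ W, l w = 0) (hl : ∀ i, l (v i) ≤ 0) (hJ : ∀ i, i ∈ J ↔ l (v i) = 0) :
    {y ∈ spanPoly W v Finset.univ | l y = 0} = spanPoly W v J := by
  apply Set.Subset.antisymm
  · rintro y ⟨hy, hy0⟩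
    refine convexHull_mono ?_ (mem_convexHull_sep_of_eq_zero l ?_ hy hy0)
    · rintro s ⟨hs | ⟨i, -, rfl⟩, hs0⟩
      · exact Or.inl hs
      · exact Or.inr ⟨i, (hJ i).2 hs0, rfl⟩
    · rintro s (hs | ⟨i, -, rfl⟩)
      · exact (hW s hs).le
      · exact hl i
  · intro y hy
    refine ⟨convexHull_mono (Set.union_subset_union_right _ (Set.image_mono (by simp))) hy, ?_⟩
    refine convexHull_min (t := {z | l z = 0}) ?_ (convex_hyperplane l.isLinear 0) hy
    rintro s (hs | ⟨i, hi, rfl⟩)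
    · exact hW s hs
    · exact (hJ i).1 hi

namespace IsFrame

variable {n m : ℕ} {W : Finset (Euc n)} {v : Fin m → Euc n}

theorem facesO_spanPoly (h : IsFrame W v) (j : ℕ) :
    facesO j (spanPoly W v Finset.univ) = spanPoly W v ''
      {J | Module.finrank ℝ (Submodule.span ℝ (W : Set (Euc n))) + J.card = j} := by
  classical
  have h0 := h.zero_mem_spanPoly Finset.univ
  ext F
  constructor
  · rintro ⟨hF, hd, hF0⟩
    obtain ⟨l, hl⟩ := hF ⟨0, hF0⟩
    have hle : ∀ y ∈ spanPoly W v Finset.univ, l y ≤ 0 := by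
      rw [hl] at hF0
      simpa using hF0.2
    have hF' : F = {y ∈ spanPoly W v Finset.univ | l y = 0} := by
      rw [hl]
      ext y
      simp only [Set.mem_ofPred_eq]
      refine and_congr_right fun hy => ⟨fun H => le_antisymm (hle y hy) ?_, fun H z hz => ?_⟩
      · simpa using H 0 h0
      · rw [H]; exact hle z hz
    have hWmem : ∀ w ∈ W, w ∈ spanPoly W v Finset.univ := fun w hw =>
      subset_convexHull ℝ _ (Or.inl hw)
    have hW : ∀ w ∈ W, l w = 0 := fun w hw => by
      have h1 := hle w (hWmem w hw)
      have h2 := hle (-w) (hWmem _ (h.neg_mem w hw))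
      rw [map_neg] at h2
      linarith
    have hFJ := sep_eq_spanPoly (l : Euc n →ₗ[ℝ] ℝ)
      (Finset.univ.filter fun i => l (v i) = 0) hW
      (fun i => hle _ ((h.mem_spanPoly_iff _ i).2 (Finset.mem_univ i))) (by simp)
    refine ⟨_, ?_, hFJ.symm.trans hF'.symm⟩
    rw [Set.mem_ofPred_eq, ← h.sdim_spanPoly, ← hFJ, ← hd, hF']
    rfl
  · rintro ⟨J, hJ, rfl⟩
    refine ⟨fun _ => ?_, (h.sdim_spanPoly J).trans hJ, h.zero_mem_spanPoly J⟩
    let l : Euc n →L[ℝ] ℝ := -(innerSL ℝ (∑ i ∈ Jᶜ, v i))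
    have hlW : ∀ w ∈ W, l w = 0 := fun w hw => by
      simp [l, h.orthogonal w hw]
    have hlv : ∀ i, l (v i) = if i ∈ J then 0 else -1 := fun i => by
      by_cases hi : i ∈ J <;> simp [l, h.inner_eq, hi]
    have hJ' := sep_eq_spanPoly (l : Euc n →ₗ[ℝ] ℝ) J hlW
      (fun i => by
        change l (v i) ≤ 0
        rw [hlv]; split_ifs <;> norm_num)
      (fun i => by
        change _ ↔ l (v i) = 0
        rw [hlv]; split_ifs with hi <;> simp [hi])
    have hle : ∀ y ∈ spanPoly W v Finset.univ, l y ≤ 0 := fun y hy => by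
      refine convexHull_min (t := {z | l z ≤ 0}) ?_
        (convex_halfSpace_le (l : Euc n →ₗ[ℝ] ℝ).isLinear 0) hy
      rintro s (hs | ⟨i, -, rfl⟩)
      · exact (hlW s hs).le
      · rw [Set.mem_ofPred_eq, hlv]; split_ifs <;> norm_num
    refine ⟨l, ?_⟩
    rw [← hJ']
    ext y
    simp only [Set.mem_ofPred_eq]
    refine and_congr_right fun hy => ⟨fun H z hz => ?_, fun H => le_antisymm (hle y hy) ?_⟩
    · have : l y = 0 := H
      rw [this]; exact hle z hz
    · simpa using H 0 h0

/-- `PhiP` of a frame polytope, as a sum over index sets. -/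
theorem PhiP_spanPoly (h : IsFrame W v) (p a₁ a₂ : ℝ) {x : Euc n} (hx : ∀ w ∈ W, ⟪x, w⟫ = 0)
    {k : ℕ} (hk : Module.finrank ℝ (Submodule.span ℝ (W : Set (Euc n))) = k) :
    PhiP p a₁ a₂ (spanPoly W v Finset.univ) x =
      (if Odd (k + m) then a₁ else 2 * a₂ - a₁)
          * (Finset.univ.fold max 0 fun i => ⟪x, v i⟫) ^ p
        + (a₂ - a₁) * ∑ j ∈ Finset.Icc 1 (k + m - 1), (-1 : ℝ) ^ j *
            ∑ J : Finset (Fin m) with k + J.card = j, (J.fold max 0 fun i => ⟪x, v i⟫) ^ p := by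
  unfold PhiP
  rw [h.sdim_spanPoly, hk, Finset.card_univ, Fintype.card_fin, h.supp_spanPoly _ hx]
  congr 2
  refine Finset.sum_congr rfl fun j _ => ?_
  rw [h.facesO_spanPoly, finsum_mem_image h.spanPoly_injective.injOn, hk]
  simp only [h.supp_spanPoly _ hx]
  congr 1
  rw [← finsum_mem_coe_finset]
  simp

end IsFrame

theorem sum_card_eq_one (f : Finset (Fin 3) → ℝ) :
    ∑ J : Finset (Fin 3) with J.card = 1, f J = f {0} + f {1} + f {2} := by
  have : (Finset.univ.filter fun J : Finset (Fin 3) => J.card = 1) = {{0}, {1}, {2}} := by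
    decide
  rw [this, Finset.sum_insert (by decide), Finset.sum_insert (by decide), Finset.sum_singleton,
    add_assoc]

theorem sum_card_eq_two (f : Finset (Fin 3) → ℝ) :
    ∑ J : Finset (Fin 3) with J.card = 2, f J = f {0, 1} + f {0, 2} + f {1, 2} := by
  have : (Finset.univ.filter fun J : Finset (Fin 3) => J.card = 2)
      = {{0, 1}, {0, 2}, {1, 2}} := by
    decide
  rw [this, Finset.sum_insert (by decide), Finset.sum_insert (by decide), Finset.sum_singleton,
    add_assoc]

/-- The alternating sum of `p`-th powers of support functions of the proper faces of a simplex
with apex `0`, seen in a direction with coordinates `x, y, z`. -/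
def faceSum (p x y z : ℝ) : ℝ :=
  max x 0 ^ p + max y 0 ^ p + max z 0 ^ p
    - (max x (max y 0) ^ p + max x (max z 0) ^ p + max y (max z 0) ^ p)

/-- The value of `PhiP` on the tetrahedron `conv {0, e₀, e₁, e₂}`. -/
def tetraVal (p a₁ a₂ x y z : ℝ) : ℝ :=
  a₁ * max x (max y (max z 0)) ^ p - (a₂ - a₁) * faceSum p x y z

/-- The value of `PhiP` on the bipyramid `conv {± e₃, e₀, e₁, e₂}`. -/
def bipyramidVal (p a₁ a₂ x y z : ℝ) : ℝ :=
  (2 * a₂ - a₁) * max x (max y (max z 0)) ^ p + (a₂ - a₁) * faceSum p x y z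

/-- The standard basis vectors of the first three coordinates. -/
def stdVec {n : ℕ} (hn : 3 ≤ n) (i : Fin 3) : Euc n :=
  EuclideanSpace.single (Fin.castLE hn i) 1

/-- The vector with coordinates `x, y, z, 0, …, 0`. -/
def stdComb {n : ℕ} (hn : 3 ≤ n) (x y z : ℝ) : Euc n :=
  x • stdVec hn 0 + y • stdVec hn 1 + z • stdVec hn 2

theorem stdVec_orthonormal {n : ℕ} (hn : 3 ≤ n) : Orthonormal ℝ (stdVec hn) := by
  have := (EuclideanSpace.basisFun (Fin n) ℝ).orthonormal.comp _ (Fin.castLE_injective hn)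
  have h : stdVec hn = EuclideanSpace.basisFun (Fin n) ℝ ∘ Fin.castLE hn := by
    funext i
    simp [stdVec]
  rwa [h]

theorem inner_stdComb {n : ℕ} (hn : 3 ≤ n) (x y z : ℝ) (w : Euc n) :
    ⟪stdComb hn x y z, w⟫
      = x * ⟪stdVec hn 0, w⟫ + y * ⟪stdVec hn 1, w⟫ + z * ⟪stdVec hn 2, w⟫ := by
  simp [stdComb, inner_add_left, inner_smul_left]

theorem inner_stdComb_stdVec {n : ℕ} (hn : 3 ≤ n) (x y z : ℝ) (i : Fin 3) :
    ⟪stdComb hn x y z, stdVec hn i⟫ = ![x, y, z] i := by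
  rw [inner_stdComb]
  simp only [orthonormal_iff_ite.1 (stdVec_orthonormal hn)]
  fin_cases i <;> simp

theorem fold_max_univ (g : Fin 3 → ℝ) :
    Finset.univ.fold max 0 g = max (g 0) (max (g 1) (max (g 2) 0)) := by
  have : (Finset.univ : Finset (Fin 3)) = {0, 1, 2} := by decide
  rw [this, Finset.fold_insert (by decide), Finset.fold_insert (by decide), Finset.fold_singleton]

theorem fold_max_pair (g : Fin 3 → ℝ) {i j : Fin 3} (h : i ≠ j) :
    ({i, j} : Finset (Fin 3)).fold max 0 g = max (g i) (max (g j) 0) := by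
  rw [Finset.fold_insert (by simpa using h), Finset.fold_singleton]

theorem tetra_isFrame {n : ℕ} (hn : 3 ≤ n) : IsFrame {0} (stdVec hn) where
  orthonormal := stdVec_orthonormal hn
  zero_mem := by simp
  neg_mem := by simp
  orthogonal := by simp

theorem PhiP_tetra {n : ℕ} (hn : 3 ≤ n) (p a₁ a₂ x y z : ℝ) :
    PhiP p a₁ a₂ (spanPoly {0} (stdVec hn) Finset.univ) (stdComb hn x y z)
      = tetraVal p a₁ a₂ x y z := by
  rw [(tetra_isFrame hn).PhiP_spanPoly p a₁ a₂ (by simp) (k := 0) (by simp)]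
  have hI : Finset.Icc 1 (0 + 3 - 1) = {1, 2} := by decide
  rw [hI, Finset.sum_insert (by decide), Finset.sum_singleton, if_pos (by decide)]
  simp only [zero_add, sum_card_eq_one, sum_card_eq_two, fold_max_univ, Finset.fold_singleton,
    inner_stdComb_stdVec]
  rw [fold_max_pair _ (by decide), fold_max_pair _ (by decide), fold_max_pair _ (by decide)]
  simp [tetraVal, faceSum]
  ring

/-- The vertices `± e₃` of a bipyramid. -/
def axisPair {n : ℕ} (hn : 4 ≤ n) : Finset (Euc n) := by
  classical
  exact {EuclideanSpace.single ⟨3, hn⟩ 1, -EuclideanSpace.single ⟨3, hn⟩ 1}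

theorem mem_axisPair {n : ℕ} (hn : 4 ≤ n) (w : Euc n) : w ∈ axisPair hn ↔
    w = EuclideanSpace.single ⟨3, hn⟩ 1 ∨ w = -EuclideanSpace.single ⟨3, hn⟩ 1 := by
  simp [axisPair]

theorem bipyramid_isFrame {n : ℕ} (hn : 4 ≤ n) :
    IsFrame (axisPair hn) (stdVec (by omega : 3 ≤ n)) where
  orthonormal := stdVec_orthonormal _
  zero_mem := by
    have hc := convex_convexHull ℝ (axisPair hn : Set (Euc n))
    have h1 := subset_convexHull ℝ (axisPair hn : Set (Euc n)) ((mem_axisPair hn _).2 (Or.inl rfl))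
    have h2 := subset_convexHull ℝ (axisPair hn : Set (Euc n)) ((mem_axisPair hn _).2 (Or.inr rfl))
    have := hc h1 h2 (a := 1 / 2) (b := 1 / 2) (by norm_num) (by norm_num) (by norm_num)
    simpa using this
  neg_mem := fun w hw => by
    rw [mem_axisPair] at hw ⊢
    rcases hw with rfl | rfl <;> simp
  orthogonal := fun w hw i => by
    have h3 : (Fin.castLE (by omega : 3 ≤ n) i) ≠ ⟨3, hn⟩ := fun h => by
      have := congrArg Fin.val h
      simp at this
      omega
    rw [mem_axisPair] at hw
    rcases hw with rfl | rfl <;> simp [stdVec, EuclideanSpace.inner_single_left, h3]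

theorem finrank_span_axisPair {n : ℕ} (hn : 4 ≤ n) :
    Module.finrank ℝ (Submodule.span ℝ (axisPair hn : Set (Euc n))) = 1 := by
  have : Submodule.span ℝ (axisPair hn : Set (Euc n))
      = Submodule.span ℝ {EuclideanSpace.single (⟨3, hn⟩ : Fin n) (1 : ℝ)} := by
    apply le_antisymm
    · refine Submodule.span_le.2 fun w hw => ?_
      rcases (mem_axisPair hn w).1 hw with rfl | rfl
      · exact Submodule.mem_span_singleton_self _
      · exact Submodule.neg_mem _ (Submodule.mem_span_singleton_self _)
    · refine Submodule.span_mono ?_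
      rintro _ rfl
      exact (mem_axisPair hn _).2 (Or.inl rfl)
  rw [this]
  exact finrank_span_singleton (by simp)

theorem PhiP_bipyramid {n : ℕ} (hn : 4 ≤ n) {p : ℝ} (hp : p ≠ 0) (a₁ a₂ x y z : ℝ) :
    PhiP p a₁ a₂ (spanPoly (axisPair hn) (stdVec (by omega : 3 ≤ n)) Finset.univ)
      (stdComb (by omega) x y z) = bipyramidVal p a₁ a₂ x y z := by
  rw [(bipyramid_isFrame hn).PhiP_spanPoly p a₁ a₂ ?_ (finrank_span_axisPair hn)]
  · have hI : Finset.Icc 1 (1 + 3 - 1) = {1, 2, 3} := by decide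
    rw [hI, Finset.sum_insert (by decide), Finset.sum_insert (by decide), Finset.sum_singleton,
      if_neg (by decide)]
    have e1 : ∀ J : Finset (Fin 3), 1 + J.card = 1 ↔ J = ∅ := fun J => by simp
    have e2 : ∀ J : Finset (Fin 3), 1 + J.card = 2 ↔ J.card = 1 := fun J => by omega
    have e3 : ∀ J : Finset (Fin 3), 1 + J.card = 3 ↔ J.card = 2 := fun J => by omega
    simp only [e1, e2, e3, Finset.filter_eq', Finset.mem_univ, if_true, Finset.sum_singleton,
      sum_card_eq_one, sum_card_eq_two, fold_max_univ, Finset.fold_singleton,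
      Finset.fold_empty, inner_stdComb_stdVec]
    rw [fold_max_pair _ (by decide), fold_max_pair _ (by decide), fold_max_pair _ (by decide)]
    simp [bipyramidVal, faceSum, Real.zero_rpow hp]
    exact Or.inl (by ring)
  · intro w hw
    simp [inner_stdComb, (bipyramid_isFrame hn).orthogonal w hw]

/-- The inequalities forced on the coefficients of the positive part. -/
theorem coeff_ineqs_of_sublinear {n : ℕ} (hn : 3 ≤ n) {p : ℝ} (hp : 1 ≤ p) {a₁ a₂ b₁ b₂ : ℝ}
    (h0 : ∀ P : Set (Euc n), IsPolytope0 P → ∀ x, 0 ≤ PhiP p a₁ a₂ P x + PhiP p b₁ b₂ P (-x))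
    (h1 : ∀ P : Set (Euc n), IsPolytope0 P → ∀ x y,
      (PhiP p a₁ a₂ P (x + y) + PhiP p b₁ b₂ P (-(x + y))) ^ (1 / p)
        ≤ (PhiP p a₁ a₂ P x + PhiP p b₁ b₂ P (-x)) ^ (1 / p)
          + (PhiP p a₁ a₂ P y + PhiP p b₁ b₂ P (-y)) ^ (1 / p)) :
    0 ≤ a₁ ∧ 0 ≤ a₂ ∧ a₁ ≤ a₂ ∧ ((1 < p ∨ (4 ≤ n ∧ p = 1)) → a₂ ≤ a₁) ∧
      (p = 1 → a₂ - a₁ ≤ b₂) := by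
  have hp0 : p ≠ 0 := by positivity
  have hq : 0 < 1 / p := by positivity
  have hneg : ∀ (x y z : ℝ), -stdComb hn x y z = stdComb hn (-x) (-y) (-z) := fun x y z => by
    simp only [stdComb]; module
  have hadd : ∀ (x y z x' y' z' : ℝ), stdComb hn x y z + stdComb hn x' y' z'
      = stdComb hn (x + x') (y + y') (z + z') := fun x y z x' y' z' => by
    simp only [stdComb]; module
  have t0 : ∀ x y z : ℝ, 0 ≤ tetraVal p a₁ a₂ x y z + tetraVal p b₁ b₂ (-x) (-y) (-z) :=
    fun x y z => by
      have := h0 _ ((tetra_isFrame hn).isPolytope0 Finset.univ) (stdComb hn x y z)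
      rwa [hneg, PhiP_tetra, PhiP_tetra] at this
  have t1 : ∀ x y z x' y' z' : ℝ, _ := fun x y z x' y' z' =>
    h1 _ ((tetra_isFrame hn).isPolytope0 Finset.univ) (stdComb hn x y z) (stdComb hn x' y' z')
  simp only [hadd, hneg, PhiP_tetra] at t1
  have ha₁ : 0 ≤ a₁ := by
    have := t0 1 1 1
    norm_num [tetraVal, faceSum, Real.zero_rpow hp0] at this
    linarith
  have ha₂ : 0 ≤ a₂ := by
    have := t0 1 0 0
    norm_num [tetraVal, faceSum, Real.zero_rpow hp0] at this
    linarith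
  have h2p : 0 ≤ (2 : ℝ) ^ p := by positivity
  have hscale : ∀ {c : ℝ}, 0 ≤ c → ((2 : ℝ) ^ p * c) ^ (1 / p) = 2 * c ^ (1 / p) := fun hc => by
    rw [Real.mul_rpow h2p hc, ← Real.rpow_mul (by norm_num), mul_one_div_cancel hp0,
      Real.rpow_one]
  have hle : a₁ ≤ a₂ := by
    by_contra! hlt
    have h := t1 1 0 1 1 1 0
    have e1 : tetraVal p a₁ a₂ (1 + 1) (0 + 1) (1 + 0)
        + tetraVal p b₁ b₂ (-(1 + 1)) (-(0 + 1)) (-(1 + 0)) = 2 ^ p * a₂ + (a₁ - a₂) := by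
      norm_num [tetraVal, faceSum, Real.zero_rpow hp0]
      ring
    have e2 : tetraVal p a₁ a₂ 1 0 1 + tetraVal p b₁ b₂ (-1) (-0) (-1) = a₂ := by
      norm_num [tetraVal, faceSum, Real.zero_rpow hp0]
    have e3 : tetraVal p a₁ a₂ 1 1 0 + tetraVal p b₁ b₂ (-1) (-1) (-0) = a₂ := by
      norm_num [tetraVal, faceSum, Real.zero_rpow hp0]
    rw [e1, e2, e3, ← two_mul, ← hscale ha₂,
      Real.rpow_le_rpow_iff (by nlinarith) (by positivity) hq] at h
    linarith
  refine ⟨ha₁, ha₂, hle, ?_, ?_⟩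
  · rintro (hp1 | ⟨h4, rfl⟩)
    · by_contra! hlt
      have h := t1 1 1 0 1 1 1
      have e1 : tetraVal p a₁ a₂ (1 + 1) (1 + 1) (0 + 1)
          + tetraVal p b₁ b₂ (-(1 + 1)) (-(1 + 1)) (-(0 + 1)) = 2 ^ p * a₂ - (a₂ - a₁) := by
        norm_num [tetraVal, faceSum, Real.zero_rpow hp0]
        ring
      have e2 : tetraVal p a₁ a₂ 1 1 0 + tetraVal p b₁ b₂ (-1) (-1) (-0) = a₂ := by
        norm_num [tetraVal, faceSum, Real.zero_rpow hp0]
      have e3 : tetraVal p a₁ a₂ 1 1 1 + tetraVal p b₁ b₂ (-1) (-1) (-1) = a₁ := by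
        norm_num [tetraVal, faceSum, Real.zero_rpow hp0]
      have hq1 : 1 / p ≤ 1 := (div_le_one (by linarith)).2 hp
      have hconc := (Real.concaveOn_rpow hq.le hq1).2
        (Set.mem_Ici.2 ha₂) (Set.mem_Ici.2 ha₁) (by norm_num : (0 : ℝ) ≤ 1 / 2)
        (by norm_num : (0 : ℝ) ≤ 1 / 2) (by norm_num)
      simp only [smul_eq_mul] at hconc
      have h2lt : (2 : ℝ) < 2 ^ p := by
        simpa using Real.rpow_lt_rpow_of_exponent_lt (by norm_num : (1 : ℝ) < 2) hp1
      have hmid : 0 ≤ 1 / 2 * a₂ + 1 / 2 * a₁ := by positivity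
      have h' : (2 ^ p * a₂ - (a₂ - a₁)) ^ (1 / p)
          ≤ (2 ^ p * (1 / 2 * a₂ + 1 / 2 * a₁)) ^ (1 / p) := by
        rw [hscale hmid]
        rw [e1, e2, e3] at h
        linarith
      rw [Real.rpow_le_rpow_iff (by nlinarith) (by positivity) hq] at h'
      nlinarith
    · have := h1 _ ((bipyramid_isFrame h4).isPolytope0 Finset.univ) (stdComb hn 4 2 1)
        (stdComb hn 4 1 2)
      rw [hadd, hneg, hneg, hneg] at this
      simp only [PhiP_bipyramid h4 hp0] at this
      norm_num [bipyramidVal, faceSum] at this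
      linarith
  · rintro rfl
    have := t1 1 1 1 1 1 (-1)
    norm_num [tetraVal, faceSum] at this
    linarith

theorem valuation_smul_eq {n : ℕ} {p : ℝ} (hp : 1 ≤ p) {a₁ a₂ b₁ b₂ c₁ c₂ : ℝ}
    {Φ : Set (Euc n) → Euc n → ℝ}
    (hform : ∀ P : Set (Euc n), IsPolytope0 P → ∀ x : Euc n,
      Φ P x = c₁ * mPlus p P x ^ p + c₂ * mMinus p P x ^ p
        + PhiP p a₁ a₂ P x + PhiP p b₁ b₂ (-P) x)
    {P : Set (Euc n)} (hP : IsPolytope0 P) {s : ℝ} (hs : 0 < s) (x : Euc n) :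
    Φ (s • P) x = s ^ p * (s ^ n * (c₁ * mPlus p P x ^ p + c₂ * mPlus p P (-x) ^ p)
      + (PhiP p a₁ a₂ P x + PhiP p b₁ b₂ P (-x))) := by
  have hp0 : p ≠ 0 := by positivity
  rw [hform _ (hP.smul_set s), mMinus_eq_mPlus_neg, mPlus_rpow_smul hp0 hs,
    mPlus_rpow_smul hp0 hs, PhiP_neg_set, PhiP_smul_set hs.ne', PhiP_smul_set hs.ne',
    PhiP_smul_of_nonneg hs.le _ _ _ hP.2, PhiP_smul_of_nonneg hs.le _ _ _ hP.2]
  ring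

/-- Lemma 5.1: if `Φ P = c₁ h_{M_p⁺P}^p + c₂ h_{M_p⁻P}^p + Φ_{p;a₁,a₂}(P) + Φ_{p;b₁,b₂}(-P)`
for all `P ∈ P_o^n`, and each `Φ P` is non-negative with `(Φ P)^{1/p}` sublinear, then all
the constants are non-negative; for `n ≥ 3, p > 1` or `n ≥ 4, p = 1` moreover `a₁ = a₂`,
`b₁ = b₂`; and for `n = 3, p = 1`: `a₁ ≤ a₂`, `b₁ ≤ b₂`, `a₂ - a₁ ≤ b₂`, `b₂ - b₁ ≤ a₂`. -/
theorem constants_of_sublinear_function_valued_valuation (n : ℕ) (hn : 3 ≤ n) (p : ℝ)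
    (hp : 1 ≤ p) (a₁ a₂ b₁ b₂ c₁ c₂ : ℝ) (Φ : Set (Euc n) → Euc n → ℝ)
    (hform : ∀ P : Set (Euc n), IsPolytope0 P → ∀ x : Euc n,
      Φ P x = c₁ * mPlus p P x ^ p + c₂ * mMinus p P x ^ p
        + PhiP p a₁ a₂ P x + PhiP p b₁ b₂ (-P) x)
    (hpos : ∀ P : Set (Euc n), IsPolytope0 P → ∀ x : Euc n, 0 ≤ Φ P x)
    (hsub : ∀ P : Set (Euc n), IsPolytope0 P →
      (∀ c : ℝ, 0 ≤ c → ∀ x : Euc n, Φ P (c • x) ^ (1 / p) = c * Φ P x ^ (1 / p)) ∧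
      (∀ x y : Euc n, Φ P (x + y) ^ (1 / p) ≤ Φ P x ^ (1 / p) + Φ P y ^ (1 / p))) :
    0 ≤ a₁ ∧ 0 ≤ a₂ ∧ 0 ≤ b₁ ∧ 0 ≤ b₂ ∧ 0 ≤ c₁ ∧ 0 ≤ c₂ ∧
      ((1 < p ∨ (4 ≤ n ∧ p = 1)) → a₁ = a₂ ∧ b₁ = b₂) ∧
      ((n = 3 ∧ p = 1) → a₁ ≤ a₂ ∧ b₁ ≤ b₂ ∧ a₂ - a₁ ≤ b₂ ∧ b₂ - b₁ ≤ a₂) := by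
  have hn0 : 0 < n := by omega
  have hp0 : 0 < p := by linarith
  have hq : 0 ≤ 1 / p := by positivity
  have hscaled : ∀ P : Set (Euc n), IsPolytope0 P → ∀ x, ∀ s : ℝ, 0 < s →
      0 ≤ s ^ n * (c₁ * mPlus p P x ^ p + c₂ * mPlus p P (-x) ^ p)
        + (PhiP p a₁ a₂ P x + PhiP p b₁ b₂ P (-x)) := fun P hP x s hs => by
    have h := hpos _ (hP.smul_set s) x
    rw [valuation_smul_eq hp hform hP hs] at h
    exact nonneg_of_mul_nonneg_right h (by positivity)
  have hroot : ∀ P : Set (Euc n), IsPolytope0 P → ∀ x, ∀ s : ℝ, 0 < s →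
      Φ (s • P) x ^ (1 / p) = s * (s ^ n * (c₁ * mPlus p P x ^ p + c₂ * mPlus p P (-x) ^ p)
        + (PhiP p a₁ a₂ P x + PhiP p b₁ b₂ P (-x))) ^ (1 / p) := fun P hP x s hs => by
    rw [valuation_smul_eq hp hform hP hs, Real.mul_rpow (by positivity) (hscaled P hP x s hs),
      ← Real.rpow_mul hs.le, mul_one_div_cancel hp0.ne', Real.rpow_one]
  have h0 : ∀ P : Set (Euc n), IsPolytope0 P → ∀ x,
      0 ≤ PhiP p a₁ a₂ P x + PhiP p b₁ b₂ P (-x) := fun P hP x =>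
    nonneg_of_forall_scaled hn0 (hscaled P hP x)
  have h1 : ∀ P : Set (Euc n), IsPolytope0 P → ∀ x y,
      (PhiP p a₁ a₂ P (x + y) + PhiP p b₁ b₂ P (-(x + y))) ^ (1 / p)
        ≤ (PhiP p a₁ a₂ P x + PhiP p b₁ b₂ P (-x)) ^ (1 / p)
          + (PhiP p a₁ a₂ P y + PhiP p b₁ b₂ P (-y)) ^ (1 / p) := fun P hP x y => by
    refine rpow_add_le_of_forall_scaled hn0 hq
      (A := c₁ * mPlus p P (x + y) ^ p + c₂ * mPlus p P (-(x + y)) ^ p)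
      (B := c₁ * mPlus p P x ^ p + c₂ * mPlus p P (-x) ^ p)
      (C := c₁ * mPlus p P y ^ p + c₂ * mPlus p P (-y) ^ p) fun s hs => ?_
    have h := (hsub _ (hP.smul_set s)).2 x y
    rw [hroot P hP _ s hs, hroot P hP _ s hs, hroot P hP _ s hs, ← mul_add] at h
    exact le_of_mul_le_mul_left h hs
  obtain ⟨ha₁, ha₂, hale, haeq, hab⟩ := coeff_ineqs_of_sublinear hn hp h0 h1
  obtain ⟨hb₁, hb₂, hble, hbeq, hba⟩ := coeff_ineqs_of_sublinear hn hp (a₁ := b₁) (a₂ := b₂)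
    (b₁ := a₁) (b₂ := a₂)
    (fun P hP x => by simpa [add_comm] using h0 P hP (-x))
    (fun P hP x y => by
      have h := h1 P hP (-x) (-y)
      rw [← neg_add, neg_neg, neg_neg, neg_neg] at h
      simpa only [add_comm (PhiP p b₁ b₂ P _)] using h)
  obtain ⟨P, hP, x, hx, hx0⟩ := exists_polytope_mPlus_pos hn0 hp0
  have hc₁ : 0 ≤ c₁ := by
    have h := leading_coeff_nonneg_of_forall_scaled hn0 (hscaled P hP x)
    rw [hx0, mul_zero, add_zero] at h
    exact nonneg_of_mul_nonneg_left h hx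
  have hc₂ : 0 ≤ c₂ := by
    have h := leading_coeff_nonneg_of_forall_scaled hn0 (hscaled P hP (-x))
    rw [neg_neg, hx0, mul_zero, zero_add] at h
    exact nonneg_of_mul_nonneg_left h hx
  exact ⟨ha₁, ha₂, hb₁, hb₂, hc₁, hc₂, fun h => ⟨hale.antisymm (haeq h), hble.antisymm (hbeq h)⟩,
    fun h => ⟨hale, hble, hab h.2, hba h.2⟩⟩
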